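/- arXiv:2503.03159 — 2 statements merged into one kernel-verified Lean document; each statement's English description precedes it below -/
import Mathlib

section
/- The sequence a_n = exp(H_n)·log(H_n)/n, for n ≥ 1, is strictly increasing: for every n ≥ 1, exp(H_n)·log(H_n)/n < exp(H_{n+1})·log(H_{n+1})/(n+1). -/
theorem one_le_harmonic_succ_and_le (n : ℕ) :
    1 ≤ harmonic (n + 1) ∧ harmonic (n + 1) ≤ n + 1 := by
  induction n with
  | zero => simp
  | succ n ih =>
    rw [harmonic_succ (n + 1)]
    push_cast
    have hpos : (0 : ℚ) < ((n : ℚ) + 1 + 1)⁻¹ := by positivity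
    have hle : ((n : ℚ) + 1 + 1)⁻¹ ≤ 1 := inv_le_one_of_one_le₀ (by linarith [n.cast_nonneg (α := ℚ)])
    constructor <;> linarith [ih.1, ih.2]

theorem harmonic_succ_mul_sub_one_le (n : ℕ) :
    harmonic (n + 1) * (harmonic (n + 1) - 1) ≤ 2 * n := by
  induction n with
  | zero => simp
  | succ n ih =>
    have hH := (one_le_harmonic_succ_and_le n).2
    rw [harmonic_succ (n + 1)]
    push_cast
    set y : ℚ := ((n : ℚ) + 1 + 1)⁻¹ with hy
    have hpos : 0 < y := by positivity
    have hmul : y * ((n : ℚ) + 1 + 1) = 1 := inv_mul_cancel₀ (by positivity)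
    have hle : y ≤ 1 := inv_le_one_of_one_le₀ (by linarith [n.cast_nonneg (α := ℚ)])
    nlinarith [mul_le_mul_of_nonneg_left hH hpos.le]

/-- The sequence `a_n = exp(H_n)·log(H_n)/n` is strictly increasing for
`n ≥ 1`. -/
theorem exp_harmonic_mul_log_div_strict_mono (n : ℕ) (hn : 1 ≤ n) :
    Real.exp (harmonic n) * Real.log (harmonic n) / n <
      Real.exp (harmonic (n + 1)) * Real.log (harmonic (n + 1)) / (n + 1) := by
  have hH : (1 : ℝ) ≤ harmonic n := by
    obtain ⟨k, rfl⟩ := Nat.exists_eq_add_of_le' hn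
    exact_mod_cast (one_le_harmonic_succ_and_le k).1
  have hK : ((harmonic (n + 1) : ℚ) : ℝ) * (harmonic (n + 1) - 1) ≤ 2 * n := by
    exact_mod_cast harmonic_succ_mul_sub_one_le n
  have hsucc : ((harmonic (n + 1) : ℚ) : ℝ) = harmonic n + ((n : ℝ) + 1)⁻¹ := by
    rw [harmonic_succ]; push_cast; rfl
  have hn' : (1 : ℝ) ≤ n := by exact_mod_cast hn
  generalize ((harmonic (n + 1) : ℚ) : ℝ) = K at *
  generalize ((harmonic n : ℚ) : ℝ) = H at *
  generalize (n : ℝ) = t at *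
  set x : ℝ := (t + 1)⁻¹ with hx
  have hx0 : 0 < x := by positivity
  have hxt : x * (t + 1) = 1 := inv_mul_cancel₀ (by positivity)
  have hK1 : 1 < K := by linarith
  have hK0 : 0 < K := by linarith
  have hlog0 : 0 < Real.log K := Real.log_pos hK1
  have hlogH : Real.log H ≤ Real.log K - x / K := by
    have h := Real.log_le_sub_one_of_pos (x := H / K) (by positivity)
    rw [Real.log_div (by positivity) (by positivity)] at h
    have : H / K - 1 = -(x / K) := by rw [hsucc]; field_simp; ring
    linarith
  have hKlog : K * Real.log K ≤ 2 * t :=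
    (mul_le_mul_of_nonneg_left (Real.log_le_sub_one_of_pos hK0) hK0.le).trans hK
  have hsmall : x * (1 + x) / 2 * (K * Real.log K) < 1 := by
    have h1 : x * (1 + x) / 2 * (K * Real.log K) ≤ x * (1 + x) / 2 * (2 * t) :=
      mul_le_mul_of_nonneg_left hKlog (by positivity)
    have h2 : x * t = 1 - x := by linarith
    have h3 : x * (1 + x) / 2 * (2 * t) = 1 - x ^ 2 := by
      linear_combination (1 + x) * h2
    nlinarith [sq_pos_of_pos hx0]
  have hdrop : (x ^ 2 + x ^ 3) / 2 * Real.log K < x / K := by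
    rw [lt_div_iff₀ hK0]
    nlinarith [mul_lt_mul_of_pos_left hsmall hx0]
  have hexp : 1 + x + x ^ 2 / 2 ≤ Real.exp x := Real.quadratic_le_exp_of_nonneg hx0.le
  have htx : 0 ≤ t * x := by positivity
  have hlog : Real.log H < t * x * Real.exp x * Real.log K := by
    have h1 : t * x * (1 + x + x ^ 2 / 2) * Real.log K ≤ t * x * Real.exp x * Real.log K := by
      gcongr
    have h2 : t * x = 1 - x := by linarith
    have h3 : t * x * (1 + x + x ^ 2 / 2) = 1 - (x ^ 2 + x ^ 3) / 2 := by rw [h2]; ring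
    rw [h3] at h1
    linarith
  rw [div_lt_iff₀ (by positivity)]
  calc Real.exp H * Real.log H < Real.exp H * (t * x * Real.exp x * Real.log K) := by gcongr
    _ = Real.exp K * Real.log K / (t + 1) * t := by
      rw [hsucc, Real.exp_add, hx]; ring
end

section
/- For every natural number n ≥ 2, if Robin's inequality holds for n, i.e., σ(n) < e^γ · n · log(log n), then the Kaneko–Lagarias inequality holds for n, i.e., σ(n) < exp(H_n)·log(H_n). -/
/-- For `n ≥ 2`, Robin's inequality for `n` implies the Kaneko–Lagarias
inequality for `n`. -/
theorem kanekoLagarias_of_robin (n : ℕ) (hn : 2 ≤ n)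
    (hrobin : (ArithmeticFunction.sigma 1 n : ℝ) <
      Real.exp Real.eulerMascheroniConstant * n * Real.log (Real.log n)) :
    (ArithmeticFunction.sigma 1 n : ℝ) <
      Real.exp (harmonic n) * Real.log (harmonic n) := by
  have hn0 : (0 : ℝ) < n := by positivity
  have hlog : 0 < Real.log n := Real.log_pos (by exact_mod_cast hn)
  have hH : Real.eulerMascheroniConstant + Real.log n < harmonic n := by
    have h := Real.eulerMascheroniConstant_lt_eulerMascheroniSeq' n
    rw [Real.eulerMascheroniSeq', if_neg (by omega)] at h
    linarith
  have hloglog : 0 < Real.log (Real.log n) :=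
    pos_of_mul_pos_right ((Nat.cast_nonneg _).trans_lt hrobin) (by positivity)
  have hexp : Real.exp Real.eulerMascheroniConstant * n < Real.exp (harmonic n) := by
    rw [← Real.exp_log hn0, ← Real.exp_add]
    exact Real.exp_lt_exp.mpr hH
  have hlogH : Real.log (Real.log n) ≤ Real.log (harmonic n) :=
    Real.log_le_log hlog (by linarith [Real.one_half_lt_eulerMascheroniConstant])
  calc (ArithmeticFunction.sigma 1 n : ℝ)
      < Real.exp Real.eulerMascheroniConstant * n * Real.log (Real.log n) := hrobin
    _ ≤ Real.exp (harmonic n) * Real.log (harmonic n) := by gcongr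
end
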